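/- Let N ≥ 1 be an integer, B ≥ 1 an integer, and 0 ≤ β ≤ 1/N. If x_1, …, x_N are real numbers with x_i ≥ β for all i and Σ_{i=1}^N x_i = 1, then N·(1/N)^B ≤ Σ_{i=1}^N x_i^B ≤ (N−1)·β^B + (1 − (N−1)β)^B. -/

import Mathlib

/-- the spreading inequality. If `x_1, …, x_N ≥ β` with `Σ x_i = 1` and
`0 ≤ β ≤ 1/N`, then `N (1/N)^B ≤ Σ x_i^B ≤ (N−1) β^B + (1 − (N−1) β)^B`. -/
theorem spreading_inequality
    (N B : ℕ) (hN : 1 ≤ N) (hB : 1 ≤ B) (β : ℝ) (hβ0 : 0 ≤ β) (hβ : β ≤ 1 / N)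
    (x : Fin N → ℝ) (hx : ∀ i, β ≤ x i) (hsum : ∑ i, x i = 1) :
    (N : ℝ) * (1 / N : ℝ) ^ B ≤ ∑ i, x i ^ B
      ∧ ∑ i, x i ^ B ≤ ((N : ℝ) - 1) * β ^ B + (1 - ((N : ℝ) - 1) * β) ^ B := by
  have hNpos : (0 : ℝ) < N := by exact_mod_cast hN
  have hx0 : ∀ i, 0 ≤ x i := fun i => hβ0.trans (hx i)
  constructor
  · have h := Real.pow_arith_mean_le_arith_mean_pow Finset.univ (fun _ : Fin N => (1 / N : ℝ)) x
      (fun i _ => by positivity) (by simp [hNpos.ne']) (fun i _ => hx0 i) B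
    rw [← Finset.mul_sum, ← Finset.mul_sum, hsum, mul_one] at h
    calc (N : ℝ) * (1 / N : ℝ) ^ B ≤ N * (1 / N * ∑ i, x i ^ B) :=
          mul_le_mul_of_nonneg_left h hNpos.le
      _ = ∑ i, x i ^ B := by field_simp
  · have hsub : ∑ i, (x i - β) = 1 - N * β := by
      rw [Finset.sum_sub_distrib, hsum]; simp
    have hM : ∀ i, x i ≤ 1 - ((N : ℝ) - 1) * β := by
      intro i
      have h := Finset.single_le_sum (f := fun i => x i - β)
        (fun j _ => sub_nonneg.2 (hx j)) (Finset.mem_univ i)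
      rw [hsub] at h
      linarith
    generalize hMM : 1 - ((N : ℝ) - 1) * β = M at hM ⊢
    have key : ∀ i, x i ^ B ≤ β ^ B +
        (∑ j ∈ Finset.range B, M ^ j * β ^ (B - 1 - j)) * (x i - β) := by
      intro i
      have h1 := geom_sum₂_mul (x i) β B
      have h2 : (∑ j ∈ Finset.range B, x i ^ j * β ^ (B - 1 - j)) * (x i - β) ≤
          (∑ j ∈ Finset.range B, M ^ j * β ^ (B - 1 - j)) * (x i - β) := by
        refine mul_le_mul_of_nonneg_right (Finset.sum_le_sum fun j _ => ?_) (sub_nonneg.2 (hx i))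
        exact mul_le_mul_of_nonneg_right (pow_le_pow_left₀ (hx0 i) (hM i) j) (pow_nonneg hβ0 _)
      linarith
    have h := Finset.sum_le_sum fun i (_ : i ∈ Finset.univ) => key i
    rw [Finset.sum_add_distrib, ← Finset.mul_sum, hsub,
      show 1 - (N : ℝ) * β = M - β by linarith, geom_sum₂_mul] at h
    simp only [Finset.sum_const, Finset.card_univ, Fintype.card_fin, nsmul_eq_mul] at h
    linarith
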